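/- Fix m ≥ 1 and let F, Fₙ : ℂ^m → ℂ^m (n ∈ ℕ) be holomorphic (complex analytic) maps such that Fₙ → F uniformly on every compact subset of ℂ^m. Assume that the Fréchet derivative DF(0) : ℂ^m → ℂ^m is a linear isomorphism. Then there exist a radius r > 0 and N ∈ ℕ such that F is injective on the closed ball of radius r centered at 0, and Fₙ is injective on that same closed ball for every n ≥ N. -/

import Mathlib

open Metric Set in
/-- A holomorphic map bounded by `K * r / 2` on `closedBall c (2 * r)` is Lipschitz with constant
`K` on `closedBall c r`. -/
theorem Differentiable.lipschitzOnWith_closedBall_of_norm_le {E F : Type*}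
    [NormedAddCommGroup E] [NormedSpace ℂ E] [NormedAddCommGroup F] [NormedSpace ℂ F]
    {g : E → F} {c : E} {r : ℝ} {K : NNReal} (hr : 0 < r)
    (hg : Differentiable ℂ g) (hb : ∀ x ∈ closedBall c (2 * r), ‖g x‖ ≤ K * r / 2) :
    LipschitzOnWith K g (closedBall c r) := by
  let : NormedSpace ℝ E := NormedSpace.restrictScalars ℝ ℂ E
  refine Convex.lipschitzOnWith_of_nnnorm_fderiv_le (𝕜 := ℂ) (fun x _ => hg x)
    (fun x hx => ?_) (convex_closedBall c r)
  have hsub : ball x r ⊆ closedBall c (2 * r) := fun y hy => by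
    have h₁ := mem_ball.1 hy
    have h₂ := mem_closedBall.1 hx
    exact mem_closedBall.2 (by linarith [dist_triangle y x c])
  have hmaps : MapsTo g (ball x r) (closedBall (g x) (K * r)) := fun y hy => by
    rw [mem_closedBall, dist_eq_norm_sub]
    linarith [norm_sub_le (g y) (g x), hb y (hsub hy), hb x (hsub (mem_ball_self hr))]
  have h := Complex.norm_fderiv_le_div_of_mapsTo_ball hg.differentiableOn hmaps hr
  rwa [mul_div_cancel_right₀ _ hr.ne'] at h

theorem ApproximatesLinearOn.add_lipschitzOnWith {𝕜 E F : Type*} [NontriviallyNormedField 𝕜]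
    [NormedAddCommGroup E] [NormedSpace 𝕜 E] [NormedAddCommGroup F] [NormedSpace 𝕜 F]
    {f g : E → F} {f' : E →L[𝕜] F} {s : Set E} {c K : NNReal}
    (hf : ApproximatesLinearOn f f' s c) (hg : LipschitzOnWith K g s) :
    ApproximatesLinearOn (f + g) f' s (c + K) := by
  intro x hx y hy
  calc ‖(f + g) x - (f + g) y - f' (x - y)‖
      = ‖(f x - f y - f' (x - y)) + (g x - g y)‖ := by simp only [Pi.add_apply]; congr 1; abel
    _ ≤ c * ‖x - y‖ + K * ‖x - y‖ :=
      (norm_add_le _ _).trans (add_le_add (hf x hx y hy) (hg.norm_sub_le hx hy))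
    _ = (c + K : NNReal) * ‖x - y‖ := by push_cast; ring

/-- if holomorphic maps `Fₙ : ℂ^m → ℂ^m` converge to `F` uniformly on
compact sets and `DF(0)` is a linear isomorphism, then there are `r > 0` and `N`
such that `F` and all `Fₙ`, `n ≥ N`, are injective on the closed ball of radius `r`
centered at `0`. -/
theorem stmt5
    (m : ℕ) (hm : 1 ≤ m)
    (F : EuclideanSpace ℂ (Fin m) → EuclideanSpace ℂ (Fin m))
    (Fn : ℕ → EuclideanSpace ℂ (Fin m) → EuclideanSpace ℂ (Fin m))
    (hF : AnalyticOnNhd ℂ F Set.univ)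
    (hFn : ∀ n, AnalyticOnNhd ℂ (Fn n) Set.univ)
    (hconv : ∀ K : Set (EuclideanSpace ℂ (Fin m)), IsCompact K →
      TendstoUniformlyOn Fn F Filter.atTop K)
    (hDF : Function.Bijective (fderiv ℂ F 0)) :
    ∃ r : ℝ, 0 < r ∧ ∃ N : ℕ,
      Set.InjOn F (Metric.closedBall 0 r) ∧
      ∀ n ≥ N, Set.InjOn (Fn n) (Metric.closedBall 0 r) := by
  let A : EuclideanSpace ℂ (Fin m) ≃L[ℂ] EuclideanSpace ℂ (Fin m) :=
    ContinuousLinearEquiv.ofBijective (fderiv ℂ F 0)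
      (LinearMap.ker_eq_bot.2 hDF.1) (LinearMap.range_eq_top.2 hDF.2)
  have hA : HasStrictFDerivAt F (A : EuclideanSpace ℂ (Fin m) →L[ℂ] EuclideanSpace ℂ (Fin m)) 0 :=
    (hF 0 (Set.mem_univ 0)).hasStrictFDerivAt
  obtain hE | hpos := A.subsingleton_or_nnnorm_symm_pos
  · exact ⟨1, one_pos, 0, Set.injOn_of_subsingleton _ _,
      fun n _ => Set.injOn_of_subsingleton _ _⟩
  set N := ‖(A.symm : EuclideanSpace ℂ (Fin m) →L[ℂ] EuclideanSpace ℂ (Fin m))‖₊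
  obtain ⟨c, hc, hcN⟩ : ∃ c : NNReal, 0 < c ∧ c + c < N⁻¹ :=
    ⟨N⁻¹ / 2 / 2, by positivity, by
      rw [add_halves]; exact NNReal.half_lt_self (inv_pos.2 hpos).ne'⟩
  obtain ⟨s, hs, happ⟩ := hA.approximates_deriv_on_nhds (Or.inr hc)
  obtain ⟨r, hr, hrs⟩ := Metric.nhds_basis_closedBall.mem_iff.1 hs
  have hFr := happ.mono_set hrs
  have hε : 0 < (c : ℝ) * r / 2 := by positivity
  obtain ⟨n₀, hn₀⟩ := Filter.eventually_atTop.1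
    (Metric.tendstoUniformlyOn_iff.1 (hconv _ (isCompact_closedBall 0 (2 * r))) _ hε)
  refine ⟨r, hr, n₀, hFr.injOn (Or.inr (le_self_add.trans_lt hcN)), fun n hn => ?_⟩
  have hdiff : Differentiable ℂ (Fn n - F) := fun x =>
    (hFn n x (Set.mem_univ x)).differentiableAt.sub (hF x (Set.mem_univ x)).differentiableAt
  have hlip := hdiff.lipschitzOnWith_closedBall_of_norm_le hr fun x hx => by
    rw [Pi.sub_apply, ← dist_eq_norm_sub, dist_comm]
    exact (hn₀ n hn x hx).le
  have h := hFr.add_lipschitzOnWith hlip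
  rw [add_sub_cancel] at h
  exact h.injOn (Or.inr hcN)
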